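/- (Existence, Case 3) Suppose 0 < β < min{β_K, β_γ}, set t* = min{η + (βΓ(α))^{1/(α−1)}, η + β/Γ(3−α)}, fix b ∈ (0, t*) with b ≥ η and βΓ(α) > (b−η)^{α−1}, and let ρ > 0. Set σ₃ = min{σ_{3,γ}, c_{3,K}, 1}, where c_{3,K} = min{(βΓ(α)−(b−η)^{α−1})/(βΓ(α)+η^{α−1}), (βΓ(α)−(b−η)^{α−1})/((1−η)^{α−1}−βΓ(α))} and σ_{3,γ} = (β + (η−b)Γ(3−α))/max{β + ηΓ(3−α), (1−η)Γ(3−α) − β}. Assume: (i) there exists a continuous δ : [0,b] → [0,∞) with f(t,u) ≥ δ(t) for all (t,u) ∈ [0,b]×[σ₃ρ, ρ]; (ii) there exist η₁, η₂ ≥ 0 with H₁[u] ≥ η₁ and H₂[u] ≥ η₂ for every u ∈ C([0,1],ℝ) satisfying min_{t∈[0,b]} u(t) ≥ σ₃‖u‖_∞ and ‖u‖_∞ = ρ; (iii) γ(0)·η₁ + η₂ + ∫₀ᵇ K(0,s)δ(s) ds > 0. Then there exist λ_ρ > 0 and u_ρ ∈ C([0,1],ℝ) with ‖u_ρ‖_∞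 = ρ such that u_ρ = λ_ρ·T(u_ρ) and σ₃ρ ≤ u_ρ(t) ≤ ρ for every t ∈ [0,b]. -/

import Mathlib

open Set MeasureTheory

/-- The Green's function `K(t,s) = β + ((η−s)^{α−1}/Γ(α))·χ_{[0,η]}(s) −
((t−s)^{α−1}/Γ(α))·χ_{[0,t]}(s)`. -/
noncomputable def Kker (α η β t s : ℝ) : ℝ :=
  β + (Set.Icc (0:ℝ) η).indicator (fun x => (η - x) ^ (α - 1) / Real.Gamma α) s
    - (Set.Icc (0:ℝ) t).indicator (fun x => (t - x) ^ (α - 1) / Real.Gamma α) s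

/-- The function `γ(t) = β/Γ(3−α) + η − t`. -/
noncomputable def gam (α η β t : ℝ) : ℝ := β / Real.Gamma (3 - α) + η - t

/-- `C([0,1],ℝ)` with the supremum norm. -/
abbrev CI := ContinuousMap (Set.Icc (0:ℝ) 1) ℝ

/- Combinatorial part: a cochain version of Sperner lemma (mod 2) -/

/-- Mod 2 coboundary of a cochain on tuples. -/
def sdDelta {V : Type*} : (List V → ZMod 2) → List V → ZMod 2
  | _, [] => 0
  | Φ, v :: τ => Φ τ + sdDelta (fun w => Φ (v :: w)) τ

lemma sdDelta_add {V : Type*} (σ : List V) : ∀ (Φ Ψ : List V → ZMod 2),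
    sdDelta (fun τ => Φ τ + Ψ τ) σ = sdDelta Φ σ + sdDelta Ψ σ := by
  induction σ with
  | nil => intro Φ Ψ; simp [sdDelta]
  | cons v τ ih =>
    intro Φ Ψ
    simp only [sdDelta]
    rw [ih]; ring

lemma sdDelta_congr {V : Type*} (σ : List V) : ∀ (Φ Ψ : List V → ZMod 2),
    (∀ p x q, σ = p ++ x :: q → Φ (p ++ q) = Ψ (p ++ q)) → sdDelta Φ σ = sdDelta Ψ σ := by
  induction σ with
  | nil => intro Φ Ψ _; simp [sdDelta]
  | cons v τ ih =>
    intro Φ Ψ h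
    simp only [sdDelta]
    rw [ih (fun w => Φ (v :: w)) (fun w => Ψ (v :: w))]
    · have := h [] v τ rfl
      simp at this; rw [this]
    · intro p x q hq
      have := h (v :: p) x q (by simp [hq])
      simpa using this

lemma sdDelta_zero {V : Type*} (σ : List V) : sdDelta (fun _ => 0) σ = 0 := by
  induction σ with
  | nil => rfl
  | cons v τ ih => simpa [sdDelta] using ih

lemma sdDelta_sdDelta {V : Type*} (σ : List V) : ∀ (Φ : List V → ZMod 2),
    sdDelta (sdDelta Φ) σ = 0 := by
  induction σ with
  | nil => intro Φ; rfl
  | cons v τ ih =>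
    intro Φ
    simp only [sdDelta]
    rw [sdDelta_add, show sdDelta (fun w => sdDelta (fun w => Φ (v :: w)) w) τ = 0 from ih _, add_zero]
    exact CharTwo.add_self_eq_zero _

/-- Pull-back of a cochain under barycentric subdivision of `n`-tuples. -/
def sdSub {V : Type*} (b : List V → V) : ℕ → (List V → ZMod 2) → List V → ZMod 2
  | 0, Φ, _ => Φ []
  | n + 1, Φ, σ => sdDelta (sdSub b n (fun τ => Φ (b σ :: τ))) σ

lemma sdSub_add {V : Type*} (b : List V → V) (n : ℕ) : ∀ (Φ Ψ : List V → ZMod 2) (σ : List V),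
    sdSub b n (fun τ => Φ τ + Ψ τ) σ = sdSub b n Φ σ + sdSub b n Ψ σ := by
  induction n with
  | zero => intro Φ Ψ σ; rfl
  | succ n ih =>
    intro Φ Ψ σ
    simp only [sdSub]
    rw [← sdDelta_add]
    congr 1
    funext τ
    exact ih _ _ _

lemma sdSub_sdDelta {V : Type*} (b : List V → V) (n : ℕ) : ∀ (Φ : List V → ZMod 2) (σ : List V),
    σ.length = n + 1 → sdSub b (n + 1) (sdDelta Φ) σ = sdDelta (sdSub b n Φ) σ := by
  induction n with
  | zero =>
    intro Φ σ hσ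
    match σ, hσ with
    | [v], _ => simp [sdSub, sdDelta]
  | succ n ih =>
    intro Φ σ hσ
    rw [sdSub]
    simp only [sdDelta]
    rw [show sdSub b (n+1) (fun τ => Φ τ + sdDelta (fun w => Φ (b σ :: w)) τ) =
      fun τ => sdSub b (n+1) Φ τ + sdSub b (n+1) (sdDelta (fun w => Φ (b σ :: w))) τ from
      funext fun τ => sdSub_add b _ _ _ _, sdDelta_add]
    rw [sdDelta_congr σ (sdSub b (n+1) (sdDelta (fun w => Φ (b σ :: w))))
      (sdDelta (sdSub b n (fun w => Φ (b σ :: w)))), sdDelta_sdDelta, add_zero]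
    intro p x q hq
    apply ih
    have : σ.length = (p ++ q).length + 1 := by rw [hq]; simp; omega
    omega

/-- `τ` is one of the pieces of the barycentric subdivision of the `n`-tuple `σ`. -/
def sdPiece {V : Type*} (b : List V → V) : ℕ → List V → List V → Prop
  | 0, _, τ => τ = []
  | n + 1, σ, τ => ∃ p x q τ', σ = p ++ x :: q ∧ τ = b σ :: τ' ∧ sdPiece b n (p ++ q) τ'

lemma sdSub_congr {V : Type*} (b : List V → V) (n : ℕ) : ∀ (Φ Ψ : List V → ZMod 2) (σ : List V),
    (∀ τ, sdPiece b n σ τ → Φ τ = Ψ τ) → sdSub b n Φ σ = sdSub b n Ψ σ := by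
  induction n with
  | zero => intro Φ Ψ σ h; exact h [] rfl
  | succ n ih =>
    intro Φ Ψ σ h
    simp only [sdSub]
    apply sdDelta_congr
    intro p x q hq
    apply ih
    intro τ hτ
    exact h _ ⟨p, x, q, τ, hq, rfl, hτ⟩

lemma sdSub_zero {V : Type*} (b : List V → V) (n : ℕ) : ∀ (σ : List V),
    sdSub b n (fun _ => 0) σ = 0 := by
  induction n with
  | zero => intro σ; rfl
  | succ n ih =>
    intro σ
    simp only [sdSub]
    rw [show sdSub b n (fun _ => 0) = fun _ => (0 : ZMod 2) from funext ih]
    exact sdDelta_zero σ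

/-- Iterated pieces. -/
def sdPieces {V : Type*} (b : List V → V) (n : ℕ) : ℕ → List V → List V → Prop
  | 0, σ, τ => τ = σ
  | m + 1, σ, τ => ∃ σ', sdPiece b n σ σ' ∧ sdPieces b n m σ' τ

/-- Iterated subdivision of cochains. -/
def sdIter {V : Type*} (b : List V → V) (n : ℕ) : ℕ → (List V → ZMod 2) → List V → ZMod 2
  | 0, Φ => Φ
  | m + 1, Φ => sdSub b n (sdIter b n m Φ)

lemma sdPiece_length {V : Type*} (b : List V → V) (n : ℕ) : ∀ (σ τ : List V),
    sdPiece b n σ τ → τ.length = n := by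
  induction n with
  | zero => intro σ τ h; simp [sdPiece] at h; simp [h]
  | succ n ih =>
    rintro σ τ ⟨p, x, q, τ', _, rfl, h⟩
    simp [ih _ _ h]

lemma sdIter_congr {V : Type*} (b : List V → V) (n m : ℕ) : ∀ (Φ Ψ : List V → ZMod 2) (σ : List V),
    (∀ τ, sdPieces b n m σ τ → Φ τ = Ψ τ) → sdIter b n m Φ σ = sdIter b n m Ψ σ := by
  induction m with
  | zero => intro Φ Ψ σ h; exact h σ rfl
  | succ m ih =>
    intro Φ Ψ σ h
    apply sdSub_congr
    intro τ hτ
    apply ih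
    intro τ' hτ'
    exact h _ ⟨τ, hτ, hτ'⟩

lemma sdIter_zero {V : Type*} (b : List V → V) (n m : ℕ) :
    sdIter b n m (fun _ => 0) = fun _ => 0 := by
  induction m with
  | zero => rfl
  | succ m ih =>
    rw [sdIter, ih]
    funext σ
    exact sdSub_zero b n σ

lemma sdIter_sdDelta {V : Type*} (b : List V → V) (n m : ℕ) (Φ : List V → ZMod 2) :
    ∀ (σ : List V), σ.length = n + 1 →
    sdIter b (n + 1) m (sdDelta Φ) σ = sdDelta (sdIter b n m Φ) σ := by
  induction m with
  | zero => intro σ _; rfl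
  | succ m ih =>
    intro σ hσ
    simp only [sdIter]
    rw [← sdSub_sdDelta b n _ σ hσ]
    apply sdSub_congr
    intro τ hτ
    exact ih τ (sdPiece_length b _ _ _ hτ)

lemma sdDelta_concat {V : Type*} (e : V) (σ : List V) : ∀ (Φ : List V → ZMod 2),
    (∀ p x q, σ = p ++ x :: q → Φ (p ++ q ++ [e]) = 0) → sdDelta Φ (σ ++ [e]) = Φ σ := by
  induction σ with
  | nil => intro Φ _; simp [sdDelta]
  | cons v τ ih =>
    intro Φ h
    simp only [List.cons_append, sdDelta]
    rw [ih]
    · have := h [] v τ rfl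
      simp at this; simp [this]
    · intro p x q hq
      have := h (v :: p) x q (by simp [hq])
      simpa using this

/-- The indicator cochain of the labels being exactly `0,…,n-1`. -/
def sdOmega {V : Type*} (l : V → ℕ) (n : ℕ) (σ : List V) : ZMod 2 :=
  if ((σ.map l : List ℕ) : Multiset ℕ) = Multiset.range n then 1 else 0

lemma sdDelta_indicator {V : Type*} (l : V → ℕ) (R : Multiset ℕ) (σ : List V) : ∀ (P : Multiset ℕ),
    sdDelta (fun τ => if P + ((τ.map l : List ℕ) : Multiset ℕ) = R then (1 : ZMod 2) else 0) σ =
    ((σ.map l).map (fun x => if P + ((σ.map l : List ℕ) : Multiset ℕ) = x ::ₘ R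
      then (1 : ZMod 2) else 0)).sum := by
  induction σ with
  | nil => intro P; simp [sdDelta]
  | cons v τ ih =>
    intro P
    simp only [sdDelta, List.map_cons, List.sum_cons]
    congr 1
    · rw [← Multiset.cons_coe, Multiset.add_cons]
      simp [Multiset.cons_inj_right]
    · have := ih (l v ::ₘ P)
      have h2 : ∀ (w : List ℕ), P + ((l v :: w : List ℕ) : Multiset ℕ) = (l v ::ₘ P) + (w : Multiset ℕ) := by
        intro w; rw [← Multiset.cons_coe, Multiset.add_cons, Multiset.cons_add]
      simp only [h2]
      exact this

lemma sdDelta_sdOmega {V : Type*} (l : V → ℕ) (n : ℕ) (σ : List V)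
    (hl : ∀ x ∈ σ, l x < n + 1) : sdDelta (sdOmega l n) σ = sdOmega l (n + 1) σ := by
  have h := sdDelta_indicator l (Multiset.range n) σ 0
  simp only [zero_add] at h
  rw [show sdOmega l n = fun τ => if ((τ.map l : List ℕ) : Multiset ℕ) = Multiset.range n
    then (1 : ZMod 2) else 0 from rfl, h]
  have hl' : ∀ y ∈ σ.map l, y < n + 1 := by
    intro y hy; rw [List.mem_map] at hy; obtain ⟨x, hx, rfl⟩ := hy; exact hl x hx
  unfold sdOmega
  generalize σ.map l = L at *
  have key : ∀ a, (L : Multiset ℕ) = a ::ₘ Multiset.range n →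
      (L.map (fun x => if (L : Multiset ℕ) = x ::ₘ Multiset.range n then (1 : ZMod 2) else 0)).sum
      = ((a ::ₘ Multiset.range n).count a : ℕ) := by
    intro a ha
    rw [ha]
    simp only [Multiset.cons_inj_left]
    rw [← ha, Multiset.coe_count]
    clear ha h hl'
    induction L with
    | nil => simp
    | cons y L ih =>
      rw [List.map_cons, List.sum_cons, ih, List.count_cons]
      by_cases hy : a = y
      · subst hy; simp; ring
      · simp [hy, Ne.symm hy]
  by_cases h1 : (L : Multiset ℕ) = Multiset.range (n + 1)
  · rw [if_pos h1, key n (by rw [h1, Multiset.range_succ])]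
    simp
  · rw [if_neg h1]
    by_cases h2 : ∃ a, (L : Multiset ℕ) = a ::ₘ Multiset.range n
    · obtain ⟨a, ha⟩ := h2
      rw [key a ha]
      have h3 : a < n + 1 := by
        apply hl'
        rw [← Multiset.mem_coe, ha]; simp
      have h4 : a ≠ n := by
        rintro rfl; exact h1 (by rw [ha, Multiset.range_succ])
      have h5 : a ∈ Multiset.range n := by simp; omega
      rw [Multiset.count_cons_self, Multiset.count_eq_one_of_mem (Multiset.nodup_range n) h5]
      rfl
    · push Not at h2
      have : (fun x => if (L : Multiset ℕ) = x ::ₘ Multiset.range n then (1 : ZMod 2) else 0) = fun _ => 0 := by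
        funext x; rw [if_neg (h2 x)]
      rw [this]; simp

/-- Barycenter of a list. -/
noncomputable def sdBary {V : Type*} [AddCommGroup V] [Module ℝ V] (σ : List V) : V :=
  ((σ.length : ℝ)⁻¹) • σ.sum

lemma sdBary_sub {V : Type*} [AddCommGroup V] [Module ℝ V] (σ : List V) (h : σ ≠ []) (v : V) :
    sdBary σ - v = ((σ.length : ℝ)⁻¹) • (σ.map (fun x => x - v)).sum := by
  have h1 : (σ.map (fun x => x - v)).sum = σ.sum - (σ.length : ℝ) • v := by
    clear h
    induction σ with
    | nil => simp
    | cons x τ ih =>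
      simp only [List.map_cons, List.sum_cons, ih, List.length_cons]
      push_cast
      rw [add_smul, one_smul]; abel
  have h2 : (σ.length : ℝ) ≠ 0 := by simpa using h
  rw [h1, smul_sub, smul_smul, inv_mul_cancel₀ h2, one_smul, sdBary]

lemma sdBary_mem {V : Type*} [AddCommGroup V] [Module ℝ V] (σ : List V) (h : σ ≠ []) (C : Set V)
    (hC : Convex ℝ C) (hσ : ∀ x ∈ σ, x ∈ C) : sdBary σ ∈ C := by
  have h2 : (σ.length : ℝ) ≠ 0 := by simpa using h
  have e : sdBary σ = ∑ i : Fin σ.length, ((σ.length : ℝ)⁻¹) • σ.get i := by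
    rw [← Finset.smul_sum, sdBary, ← List.sum_ofFn, List.ofFn_get]
  rw [e]
  apply hC.sum_mem
  · intro i _; positivity
  · simp [h2]
  · intro i _; exact hσ _ (List.get_mem _ _)

lemma sdPiece_mem {V : Type*} [AddCommGroup V] [Module ℝ V] (n : ℕ) (C : Set V)
    (hC : Convex ℝ C) : ∀ (σ τ : List V), (∀ x ∈ σ, x ∈ C) → sdPiece sdBary n σ τ →
    ∀ x ∈ τ, x ∈ C := by
  induction n with
  | zero => intro σ τ _ h; simp [sdPiece] at h; simp [h]
  | succ n ih =>
    rintro σ τ hσ ⟨p, x, q, τ', rfl, rfl, h⟩ y hy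
    rw [List.mem_cons] at hy
    rcases hy with rfl | hy
    · exact sdBary_mem _ (by simp) C hC hσ
    · refine ih (p ++ q) τ' ?_ h y hy
      intro z hz
      apply hσ
      simp at hz ⊢; tauto

lemma sdPieces_mem {V : Type*} [AddCommGroup V] [Module ℝ V] (n m : ℕ) (C : Set V)
    (hC : Convex ℝ C) : ∀ (σ τ : List V), (∀ x ∈ σ, x ∈ C) → sdPieces sdBary n m σ τ →
    ∀ x ∈ τ, x ∈ C := by
  induction m with
  | zero => rintro σ τ hσ rfl; exact hσ
  | succ m ih =>
    rintro σ τ hσ ⟨σ', h1, h2⟩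
    exact ih σ' τ (sdPiece_mem n C hC σ σ' hσ h1) h2

/-- Sperner lemma for the iterated barycentric subdivision. -/
lemma sdSperner {V : Type*} [AddCommGroup V] [Module ℝ V] (N : ℕ) (e : ℕ → V) (l : V → ℕ)
    (hl : ∀ S : Finset ℕ, S ⊆ Finset.range N → ∀ v ∈ convexHull ℝ (e '' (S : Set ℕ)), l v ∈ S)
    (m n : ℕ) (hn : n ≤ N) :
    sdIter sdBary n m (sdOmega l n) ((List.range n).map e) = 1 := by
  induction n with
  | zero =>
    have h : ∀ m, sdIter sdBary 0 m (sdOmega l 0) ([] : List V) = 1 := by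
      intro m
      induction m with
      | zero => simp [sdIter, sdOmega]
      | succ m ih => simpa [sdIter, sdSub] using ih
    simpa using h m
  | succ n ih =>
    have ih := ih (by omega)
    rw [sdIter_congr sdBary (n+1) m (sdOmega l (n+1)) (sdDelta (sdOmega l n)),
      sdIter_sdDelta _ _ _ _ _ (by simp), List.range_succ, List.map_append, List.map_singleton,
      sdDelta_concat, ih]
    · intro p x q hpq
      have hnd : (List.range n).Nodup := List.nodup_range
      obtain ⟨p', r', h1, rfl, h2⟩ := List.map_eq_append_iff.1 hpq
      obtain ⟨i, q', rfl, rfl, rfl⟩ := List.map_eq_cons_iff.1 h2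
      rw [sdIter_congr sdBary n m (sdOmega l n) (fun _ => 0), sdIter_zero]
      intro τ hτ
      have hi : i < n := by
        rw [← List.mem_range, h1]; simp
      have hS : (Finset.range (n+1)).erase i ⊆ Finset.range N := by
        intro j hj; simp at hj ⊢; omega
      have hmem := sdPieces_mem n m _
        (convex_convexHull ℝ (e '' (((Finset.range (n+1)).erase i : Finset ℕ) : Set ℕ))) _ τ
        (by
          intro x hx
          apply subset_convexHull
          have : ∃ j, j < n + 1 ∧ j ≠ i ∧ e j = x := by
            rw [h1] at hnd
            have hlt : ∀ j ∈ p' ++ i :: q', j < n := by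
              intro j hj; rw [← h1] at hj; simpa using hj
            simp only [List.mem_append, List.mem_map, List.mem_singleton] at hx
            rcases hx with (⟨j, hj, rfl⟩ | ⟨j, hj, rfl⟩) | rfl
            · refine ⟨j, ?_, ?_, rfl⟩
              · have := hlt j (by simp [hj]); omega
              · rintro rfl
                rw [List.nodup_append] at hnd
                exact hnd.2.2 j hj j (by simp) rfl
            · refine ⟨j, ?_, ?_, rfl⟩
              · have := hlt j (by simp [hj]); omega
              · rintro rfl
                rw [List.nodup_append, List.nodup_cons] at hnd
                exact hnd.2.1.1 hj
            · exact ⟨n, by omega, by omega, rfl⟩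
          obtain ⟨j, hj, hji, rfl⟩ := this
          exact ⟨j, by simp [hji]; omega, rfl⟩) hτ
      unfold sdOmega
      rw [if_neg]
      intro hEq
      have : i ∈ ((τ.map l : List ℕ) : Multiset ℕ) := by rw [hEq]; simpa using hi
      rw [Multiset.mem_coe, List.mem_map] at this
      obtain ⟨x, hx, hxi⟩ := this
      have := hl _ hS x (hmem x hx)
      simp [hxi] at this
    · intro τ hτ
      symm
      apply sdDelta_sdOmega
      intro x hx
      have hmem := sdPieces_mem (n+1) m _
        (convex_convexHull ℝ (e '' ((Finset.range (n+1) : Finset ℕ) : Set ℕ))) _ τ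
        (by
          intro x hx
          apply subset_convexHull
          simpa using hx) hτ
      simpa using hl (Finset.range (n+1)) (by intro j; simp; omega) x (hmem x hx)

lemma sdPiece_dist {V : Type*} [NormedAddCommGroup V] [NormedSpace ℝ V] (N : ℕ) (d : ℝ)
    (hd : 0 ≤ d) (n : ℕ) :
    ∀ (σ τ : List V), n ≤ N → σ.length = n → (∀ x ∈ σ, ∀ y ∈ σ, ‖x - y‖ ≤ d) →
    sdPiece sdBary n σ τ → ∀ x ∈ τ, ∀ y ∈ τ, ‖x - y‖ ≤ (1 - (N : ℝ)⁻¹) * d := by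
  induction n with
  | zero => intro σ τ _ _ _ h; simp [sdPiece] at h; simp [h]
  | succ n ih =>
    rintro σ τ hn hσ hdist ⟨p, x, q, τ', hpq, rfl, h⟩
    have hN : (0 : ℝ) < N := by exact_mod_cast (by omega : 0 < N)
    have hr : 0 ≤ (1 - (N : ℝ)⁻¹) * d := by
      apply mul_nonneg _ hd
      rw [sub_nonneg]
      exact inv_le_one_of_one_le₀ (by exact_mod_cast (by omega : 1 ≤ N))
    have hsub : ∀ z ∈ p ++ q, z ∈ σ := by
      intro z hz; rw [hpq]; simp at hz ⊢; tauto
    have hlen : (p ++ q).length = n := by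
      have : σ.length = (p ++ q).length + 1 := by rw [hpq]; simp; omega
      omega
    have hτ' := ih (p ++ q) τ' (by omega) hlen
      (fun x hx y hy => hdist x (hsub x hx) y (hsub y hy)) h
    have hball : ∀ v ∈ σ, v ∈ Metric.closedBall (sdBary σ) ((1 - (N : ℝ)⁻¹) * d) := by
      intro v hv
      rw [Metric.mem_closedBall', dist_eq_norm, sdBary_sub σ (by rw [hpq]; simp), norm_smul]
      obtain ⟨a, c, hac⟩ := List.append_of_mem hv
      have hb : ∀ L : List V, (∀ x ∈ L, ‖x - v‖ ≤ d) → ‖(L.map (fun x => x - v)).sum‖ ≤ L.length * d := by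
        intro L
        induction L with
        | nil => simp
        | cons y L ihL =>
          intro hL
          simp only [List.map_cons, List.sum_cons, List.length_cons]
          have h1 := ihL (fun x hx => hL x (by simp [hx]))
          have h2 := hL y (by simp)
          have h3 := norm_add_le (y - v) (L.map (fun x => x - v)).sum
          push_cast
          linarith
      have h1 : (σ.map (fun x => x - v)).sum = ((a ++ c).map (fun x => x - v)).sum := by
        rw [hac]; simp
      have h2 : (a ++ c).length = n := by
        have : σ.length = (a ++ c).length + 1 := by rw [hac]; simp; omega
        omega
      have h3 := hb (a ++ c) (fun x hx => hdist x (by rw [hac]; simp at hx ⊢; tauto) v hv)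
      rw [h2] at h3
      rw [h1, hσ]
      have hn1 : (0 : ℝ) < ((n + 1 : ℕ) : ℝ) := by positivity
      have h4 : (N : ℝ)⁻¹ ≤ (((n + 1 : ℕ) : ℝ))⁻¹ :=
        inv_anti₀ hn1 (by exact_mod_cast hn)
      calc ‖(((n + 1 : ℕ) : ℝ))⁻¹‖ * ‖((a ++ c).map (fun x => x - v)).sum‖
          ≤ (((n + 1 : ℕ) : ℝ))⁻¹ * (n * d) := by
            rw [Real.norm_of_nonneg (by positivity)]
            gcongr
        _ = (1 - (((n + 1 : ℕ) : ℝ))⁻¹) * d := by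
            push_cast at hn1 ⊢
            field_simp
            ring
        _ ≤ _ := by gcongr
    have hτmem := sdPiece_mem n _ (convex_closedBall (sdBary σ) ((1 - (N : ℝ)⁻¹) * d)) (p ++ q) τ'
      (fun z hz => hball z (hsub z hz)) h
    intro y hy z hz
    rw [List.mem_cons] at hy hz
    rcases hy with rfl | hy <;> rcases hz with rfl | hz
    · simpa using hr
    · have := hτmem z hz
      rwa [Metric.mem_closedBall', dist_eq_norm] at this
    · have := hτmem y hy
      rwa [Metric.mem_closedBall, dist_eq_norm] at this
    · exact hτ' y hy z hz

lemma sdPieces_dist {V : Type*} [NormedAddCommGroup V] [NormedSpace ℝ V] (n m : ℕ) (hn : 0 < n) :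
    ∀ (σ τ : List V) (d : ℝ), 0 ≤ d → σ.length = n → (∀ x ∈ σ, ∀ y ∈ σ, ‖x - y‖ ≤ d) →
    sdPieces sdBary n m σ τ → ∀ x ∈ τ, ∀ y ∈ τ, ‖x - y‖ ≤ (1 - (n : ℝ)⁻¹) ^ m * d := by
  induction m with
  | zero => rintro σ τ d hd _ h rfl; simpa using h
  | succ m ih =>
    rintro σ τ d hd hσ h ⟨σ', h1, h2⟩
    have hr : 0 ≤ (1 - (n : ℝ)⁻¹) := by
      rw [sub_nonneg]
      exact inv_le_one_of_one_le₀ (by exact_mod_cast (by omega : 1 ≤ n))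
    have := ih σ' τ ((1 - (n : ℝ)⁻¹) * d) (by positivity) (sdPiece_length _ _ _ _ h1)
      (sdPiece_dist n d hd n σ σ' le_rfl hσ h h1) h2
    rw [pow_succ, mul_assoc]
    exact this

/- Brouwer fixed point theorem on the standard simplex -/

lemma sdBrouwer_label {n : ℕ} {v w : Fin n → ℝ} (hv : v ∈ stdSimplex ℝ (Fin n))
    (hw : w ∈ stdSimplex ℝ (Fin n)) : ∃ i, 0 < v i ∧ w i ≤ v i := by
  by_contra! h
  have h1 : ∀ i ∈ Finset.univ, v i ≤ w i := by
    intro i _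
    rcases (hv.1 i).lt_or_eq with h2 | h2
    · exact (h i h2).le
    · rw [← h2]; exact hw.1 i
  have h2 : ∃ i ∈ Finset.univ, v i < w i := by
    by_contra! h3
    have h4 : ∀ i, v i = 0 := by
      intro i
      by_contra h5
      have h6 := lt_of_le_of_ne (hv.1 i) (Ne.symm h5)
      have := h i h6
      have := h3 i (Finset.mem_univ i)
      linarith
    have := hv.2
    simp [h4] at this
  have := Finset.sum_lt_sum h1 h2
  rw [hv.2, hw.2] at this
  exact lt_irrefl _ this

lemma sdBrouwer_approx {n : ℕ} (hn : 0 < n) (g : (Fin n → ℝ) → (Fin n → ℝ))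
    (hg : ContinuousOn g (stdSimplex ℝ (Fin n)))
    (hmaps : Set.MapsTo g (stdSimplex ℝ (Fin n)) (stdSimplex ℝ (Fin n))) (ε : ℝ) (hε : 0 < ε) :
    ∃ w ∈ stdSimplex ℝ (Fin n), ∀ i, g w i ≤ w i + ε := by
  classical
  have huc := (isCompact_stdSimplex ℝ (Fin n)).uniformContinuousOn_of_continuous hg
  rw [Metric.uniformContinuousOn_iff] at huc
  obtain ⟨d, hd, huc⟩ := huc (ε / 2) (by positivity)
  set e : ℕ → (Fin n → ℝ) := fun k j => if (j : ℕ) = k then 1 else 0 with he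
  set l : (Fin n → ℝ) → ℕ := fun v =>
    if h : ∃ i : Fin n, 0 < v i ∧ g v i ≤ v i then (h.choose : ℕ) else 0 with hldef
  have hhull : ∀ S : Finset ℕ, S ⊆ Finset.range n → ∀ v ∈ convexHull ℝ (e '' (S : Set ℕ)),
      v ∈ stdSimplex ℝ (Fin n) ∧ ∀ j : Fin n, (j : ℕ) ∉ S → v j = 0 := by
    intro S hS v hv
    have : convexHull ℝ (e '' (S : Set ℕ)) ⊆ stdSimplex ℝ (Fin n) ∩
        {v | ∀ j : Fin n, (j : ℕ) ∉ S → v j = 0} := by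
      apply convexHull_min
      · rintro _ ⟨k, hk, rfl⟩
        have hkn : k < n := by simpa using hS hk
        refine ⟨⟨?_, ?_⟩, ?_⟩
        · intro j; simp only [he]; split_ifs <;> norm_num
        · rw [Finset.sum_eq_single (⟨k, hkn⟩ : Fin n)]
          · simp [he]
          · intro j _ hj
            have : (j : ℕ) ≠ k := fun h => hj (Fin.ext h)
            simp [he, this]
          · simp
        · intro j hj
          have : (j : ℕ) ≠ k := by rintro rfl; exact hj hk
          simp [he, this]
      · apply (convex_stdSimplex ℝ (Fin n)).inter
        intro x hx y hy a b _ _ _ j hj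
        simp [hx j hj, hy j hj]
    exact this hv
  have hlspec : ∀ v ∈ stdSimplex ℝ (Fin n), ∃ i : Fin n, l v = i ∧ 0 < v i ∧ g v i ≤ v i := by
    intro v hv
    have h := sdBrouwer_label hv (hmaps hv)
    refine ⟨h.choose, ?_, h.choose_spec⟩
    simp only [hldef]; rw [dif_pos h]
  have hl : ∀ S : Finset ℕ, S ⊆ Finset.range n → ∀ v ∈ convexHull ℝ (e '' (S : Set ℕ)), l v ∈ S := by
    intro S hS v hv
    obtain ⟨h1, h2⟩ := hhull S hS v hv
    obtain ⟨i, h3, h4, _⟩ := hlspec v h1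
    rw [h3]
    by_contra h5
    rw [h2 i h5] at h4
    exact lt_irrefl _ h4
  have hr0 : 0 ≤ (1 - (n : ℝ)⁻¹) := by
    rw [sub_nonneg]
    exact inv_le_one_of_one_le₀ (by exact_mod_cast (by omega : 1 ≤ n))
  have hr1 : (1 - (n : ℝ)⁻¹) < 1 := by
    have : (0 : ℝ) < (n : ℝ)⁻¹ := by positivity
    linarith
  obtain ⟨m, hm⟩ := exists_pow_lt_of_lt_one (show 0 < min d (ε / 2) by positivity) hr1
  have hS := sdSperner n e l hl m n le_rfl
  have hex : ∃ τ, sdPieces sdBary n m ((List.range n).map e) τ ∧ sdOmega l n τ ≠ 0 := by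
    by_contra! h
    rw [sdIter_congr sdBary n m (sdOmega l n) (fun _ => 0) _ h, sdIter_zero] at hS
    exact zero_ne_one hS
  obtain ⟨τ, hτ, hω⟩ := hex
  have hlab : ((τ.map l : List ℕ) : Multiset ℕ) = Multiset.range n := by
    by_contra h; exact hω (if_neg h)
  have hτmem : ∀ x ∈ τ, x ∈ stdSimplex ℝ (Fin n) := by
    apply sdPieces_mem n m _ (convex_stdSimplex ℝ (Fin n)) _ τ _ hτ
    intro x hx
    refine (hhull (Finset.range n) subset_rfl x (subset_convexHull _ _ ?_)).1
    simpa using hx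
  have hdist := sdPieces_dist n m hn _ τ 1 zero_le_one (by simp) (by
    intro x hx y hy
    rw [List.mem_map] at hx hy
    obtain ⟨i, _, rfl⟩ := hx
    obtain ⟨j, _, rfl⟩ := hy
    rw [pi_norm_le_iff_of_nonneg zero_le_one]
    intro k
    simp only [he, Pi.sub_apply]
    split_ifs <;> norm_num) hτ
  have hpt : ∀ i : Fin n, ∃ x ∈ τ, g x i ≤ x i := by
    intro i
    have : (i : ℕ) ∈ ((τ.map l : List ℕ) : Multiset ℕ) := by rw [hlab]; simp
    rw [Multiset.mem_coe, List.mem_map] at this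
    obtain ⟨x, hx, hxi⟩ := this
    obtain ⟨j, h1, h2, h3⟩ := hlspec x (hτmem x hx)
    have : i = j := Fin.ext (by omega)
    subst this
    exact ⟨x, hx, h3⟩
  obtain ⟨w, hw, _⟩ := hpt ⟨0, hn⟩
  refine ⟨w, hτmem w hw, fun i => ?_⟩
  obtain ⟨x, hx, hxi⟩ := hpt i
  have h1 : ‖w - x‖ < min d (ε / 2) := by
    have := hdist w hw x hx
    linarith
  have h2 := huc w (hτmem w hw) x (hτmem x hx) (by
    rw [dist_eq_norm]; exact lt_of_lt_of_le h1 (min_le_left _ _))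
  rw [dist_eq_norm] at h2
  have h3 := norm_le_pi_norm (g w - g x) i
  have h4 := norm_le_pi_norm (w - x) i
  rw [Pi.sub_apply, Real.norm_eq_abs, abs_le] at h3 h4
  have h5 := lt_of_lt_of_le h1 (min_le_right _ _)
  linarith [h3.2, h4.1]

lemma sdBrouwer {n : ℕ} (hn : 0 < n) (g : (Fin n → ℝ) → (Fin n → ℝ))
    (hg : ContinuousOn g (stdSimplex ℝ (Fin n)))
    (hmaps : Set.MapsTo g (stdSimplex ℝ (Fin n)) (stdSimplex ℝ (Fin n))) :
    ∃ w ∈ stdSimplex ℝ (Fin n), g w = w := by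
  have hcont : ContinuousOn (fun w => ∑ i, max 0 (g w i - w i)) (stdSimplex ℝ (Fin n)) := by
    apply continuousOn_finsetSum
    intro i _
    exact continuousOn_const.sup
      (((continuous_apply i).comp_continuousOn hg).sub (continuous_apply i).continuousOn)
  obtain ⟨w1, hw1, _⟩ := sdBrouwer_approx hn g hg hmaps 1 one_pos
  obtain ⟨w, hw, hmin⟩ := (isCompact_stdSimplex ℝ (Fin n)).exists_isMinOn ⟨w1, hw1⟩ hcont
  have hz : ∑ i, max 0 (g w i - w i) ≤ 0 := by
    apply le_of_forall_pos_le_add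
    intro ε hε
    have hn' : (0 : ℝ) < n := by exact_mod_cast hn
    obtain ⟨v, hv, hvi⟩ := sdBrouwer_approx hn g hg hmaps (ε / n) (by positivity)
    have h1 := hmin hv
    simp only [Set.mem_ofPred_eq] at h1
    have h2 : ∑ i, max 0 (g v i - v i) ≤ ∑ _i : Fin n, ε / n := by
      apply Finset.sum_le_sum
      intro i _
      apply max_le (by positivity)
      linarith [hvi i]
    have h3 : ∑ _i : Fin n, ε / n = ε := by
      simp; field_simp
    linarith
  have hle : ∀ i ∈ Finset.univ, g w i ≤ w i := by
    intro i _
    have h1 := Finset.single_le_sum (f := fun i => max 0 (g w i - w i))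
      (fun j _ => le_max_left _ _) (Finset.mem_univ i)
    have h2 := le_max_right 0 (g w i - w i)
    linarith
  refine ⟨w, hw, ?_⟩
  have := (Finset.sum_eq_sum_iff_of_le hle).1 (by rw [hw.2, (hmaps hw).2])
  funext i
  exact this i (Finset.mem_univ i)

/- Schauder fixed point theorem -/

lemma sdSchauder_approx {E : Type*} [NormedAddCommGroup E] [NormedSpace ℝ E] (D K : Set E)
    (hD : Convex ℝ D) (hDne : D.Nonempty) (hK : IsCompact K) (hKD : K ⊆ D) (F : E → E)
    (hF : ContinuousOn F D) (hFK : Set.MapsTo F D K) (ε : ℝ) (hε : 0 < ε) :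
    ∃ x ∈ D, ‖F x - x‖ ≤ ε := by
  classical
  obtain ⟨t, htK, htf, hcov⟩ := Metric.totallyBounded_iff.1 hK.totallyBounded |> fun h => by
    exact (Metric.finite_approx_of_totallyBounded hK.totallyBounded ε hε)
  obtain ⟨x0, hx0⟩ := hDne
  obtain ⟨n, y, hy⟩ : ∃ (n : ℕ) (y : Fin n → E), Set.range y = t := by
    obtain ⟨n, ⟨φ⟩⟩ := htf.to_subtype |> finite_iff_exists_equiv_fin.1
    refine ⟨n, fun i => (φ.symm i : E), ?_⟩
    ext z
    constructor
    · rintro ⟨i, rfl⟩; exact (φ.symm i).2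
    · intro hz; exact ⟨φ ⟨z, hz⟩, by simp⟩
  have hyK : ∀ i, y i ∈ K := fun i => htK (hy ▸ Set.mem_range_self i)
  have hcov' : ∀ z ∈ K, ∃ i, dist z (y i) < ε := by
    intro z hz
    have := hcov hz
    simp only [Set.mem_iUnion, Metric.mem_ball] at this
    obtain ⟨p, hp, hpz⟩ := this
    rw [← hy] at hp
    obtain ⟨i, rfl⟩ := hp
    exact ⟨i, hpz⟩
  have hn : 0 < n := by
    obtain ⟨i, _⟩ := hcov' _ (hFK hx0)
    exact lt_of_le_of_lt (Nat.zero_le _) i.2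
  let φ : Fin n → E → ℝ := fun i z => max 0 (ε - dist z (y i))
  have hφ0 : ∀ i z, 0 ≤ φ i z := fun i z => le_max_left _ _
  have hφc : ∀ i, Continuous (φ i) := by
    intro i; exact continuous_const.max (continuous_const.sub (continuous_id.dist continuous_const))
  let s : E → ℝ := fun z => ∑ i, φ i z
  have hsc : Continuous s := continuous_finsetSum _ (fun i _ => hφc i)
  have hs : ∀ z ∈ K, 0 < s z := by
    intro z hz
    obtain ⟨i, hi⟩ := hcov' z hz
    apply Finset.sum_pos' (fun j _ => hφ0 j z)
    exact ⟨i, Finset.mem_univ i, lt_max_of_lt_right (by linarith)⟩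
  let X : (Fin n → ℝ) → E := fun w => ∑ i, w i • y i
  have hXc : Continuous X := by
    apply continuous_finsetSum
    intro i _
    exact (continuous_apply i).smul continuous_const
  have hXD : ∀ w ∈ stdSimplex ℝ (Fin n), X w ∈ D := by
    intro w hw
    exact hD.sum_mem (fun i _ => hw.1 i) hw.2 (fun i _ => hKD (hyK i))
  obtain ⟨w, hw, hfix⟩ := sdBrouwer hn (fun w i => φ i (F (X w)) / s (F (X w)))
    (by
      have hFX : ContinuousOn (fun w => F (X w)) (stdSimplex ℝ (Fin n)) :=
        hF.comp hXc.continuousOn hXD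
      rw [continuousOn_pi]
      intro i
      apply ContinuousOn.div
      · exact (hφc i).comp_continuousOn hFX
      · exact hsc.comp_continuousOn hFX
      · intro w hw; exact (hs _ (hFK (hXD w hw))).ne')
    (by
      intro w hw
      have h := hs _ (hFK (hXD w hw))
      refine ⟨fun i => div_nonneg (hφ0 _ _) h.le, ?_⟩
      rw [← Finset.sum_div]
      exact div_self h.ne')
  refine ⟨X w, hXD w hw, ?_⟩
  set z := F (X w) with hz
  have hs' := hs z (hFK (hXD w hw))
  have hwi : ∀ i, φ i z / s z = w i := fun i => congrFun hfix i
  have e1 : F (X w) - X w = ∑ i, w i • (z - y i) := by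
    simp only [smul_sub, Finset.sum_sub_distrib, ← Finset.sum_smul, hw.2, one_smul]
    rfl
  rw [e1]
  calc ‖∑ i, w i • (z - y i)‖ ≤ ∑ i, ‖w i • (z - y i)‖ := norm_sum_le _ _
    _ ≤ ∑ i, w i * ε := by
      apply Finset.sum_le_sum
      intro i _
      rw [norm_smul, Real.norm_of_nonneg (hw.1 i)]
      by_cases hd : dist z (y i) < ε
      · rw [← dist_eq_norm]
        exact mul_le_mul_of_nonneg_left hd.le (hw.1 i)
      · have : w i = 0 := by
          rw [← hwi i]
          have : φ i z = 0 := max_eq_left (by linarith)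
          rw [this, zero_div]
        simp [this]
    _ = ε := by rw [← Finset.sum_mul, hw.2, one_mul]

lemma sdSchauder {E : Type*} [NormedAddCommGroup E] [NormedSpace ℝ E] (D K : Set E)
    (hD : Convex ℝ D) (hDne : D.Nonempty) (hK : IsCompact K) (hKD : K ⊆ D) (F : E → E)
    (hF : ContinuousOn F D) (hFK : Set.MapsTo F D K) : ∃ x ∈ D, F x = x := by
  have hx : ∀ k : ℕ, ∃ x ∈ D, ‖F x - x‖ ≤ 1 / ((k : ℝ) + 1) := fun k =>
    sdSchauder_approx D K hD hDne hK hKD F hF hFK _ (by positivity)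
  choose x hxD hxF using hx
  obtain ⟨z, hz, φ, hφ, hlim⟩ := hK.tendsto_subseq (fun k => hFK (hxD k))
  have h0 : Filter.Tendsto (fun k => F (x (φ k)) - x (φ k)) Filter.atTop (nhds 0) := by
    apply squeeze_zero_norm (fun k => hxF (φ k))
    exact tendsto_one_div_add_atTop_nhds_zero_nat.comp hφ.tendsto_atTop
  have h1 : Filter.Tendsto (fun k => x (φ k)) Filter.atTop (nhds z) := by
    have := hlim.sub h0
    simpa using this
  have h2 : Filter.Tendsto (fun k => F (x (φ k))) Filter.atTop (nhds (F z)) := by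
    have := (hF z (hKD hz)).tendsto
    exact this.comp (tendsto_nhdsWithin_iff.2 ⟨h1, Filter.Eventually.of_forall (fun k => hxD _)⟩)
  exact ⟨z, hKD hz, tendsto_nhds_unique h2 hlim⟩

/- Compactness in `C([0,1])` and the Birkhoff-Kellogg theorem in a cone -/

lemma ciCompact (R A B a : ℝ) (ha : 0 < a) :
    IsCompact {v : CI | (∀ t, |v t| ≤ R) ∧
      ∀ t t' : Set.Icc (0:ℝ) 1, |v t - v t'| ≤ A * dist t t' + B * dist t t' ^ a} := by
  have hmod : Continuous (fun r : ℝ => A * r + B * r ^ a) :=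
    (continuous_const.mul continuous_id).add
      (continuous_const.mul (Real.continuous_rpow_const ha.le))
  have hequi : ∀ t : Set.Icc (0:ℝ) 1, Filter.Tendsto
      (fun t' : Set.Icc (0:ℝ) 1 => A * dist t t' + B * dist t t' ^ a) (nhds t) (nhds 0) := by
    intro t
    have h : Continuous (fun t' : Set.Icc (0:ℝ) 1 => A * dist t t' + B * dist t t' ^ a) :=
      hmod.comp (continuous_const.dist continuous_id)
    have := h.tendsto t
    simpa [Real.zero_rpow ha.ne'] using this
  apply ArzelaAscoli.isCompact_of_equicontinuous
  · have himg : (ContinuousMap.toFun '' {v : CI | (∀ t, |v t| ≤ R) ∧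
        ∀ t t' : Set.Icc (0:ℝ) 1, |v t - v t'| ≤ A * dist t t' + B * dist t t' ^ a}) =
        {g : Set.Icc (0:ℝ) 1 → ℝ | (∀ t, |g t| ≤ R) ∧
        ∀ t t' : Set.Icc (0:ℝ) 1, |g t - g t'| ≤ A * dist t t' + B * dist t t' ^ a} := by
      ext g
      constructor
      · rintro ⟨v, hv, rfl⟩; exact hv
      · intro hg
        refine ⟨⟨g, ?_⟩, hg, rfl⟩
        rw [continuous_iff_continuousAt]
        intro t
        rw [ContinuousAt, tendsto_iff_dist_tendsto_zero]
        refine squeeze_zero (fun _ => dist_nonneg) (fun t' => ?_) (hequi t)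
        rw [dist_comm, Real.dist_eq]
        exact hg.2 t t'
    rw [himg]
    apply IsCompact.of_isClosed_subset
      (isCompact_univ_pi (fun _ : Set.Icc (0:ℝ) 1 => isCompact_Icc (a := -R) (b := R)))
    · apply IsClosed.inter
      · have : {g : Set.Icc (0:ℝ) 1 → ℝ | ∀ t, |g t| ≤ R} = ⋂ t, {g | |g t| ≤ R} := by
          ext g; simp
        change IsClosed {g : Set.Icc (0:ℝ) 1 → ℝ | ∀ t, |g t| ≤ R}
        rw [this]
        exact isClosed_iInter fun t => isClosed_le (continuous_apply t).abs continuous_const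
      · have : {g : Set.Icc (0:ℝ) 1 → ℝ | ∀ t t' : Set.Icc (0:ℝ) 1,
            |g t - g t'| ≤ A * dist t t' + B * dist t t' ^ a} =
            ⋂ t, ⋂ t', {g | |g t - g t'| ≤ A * dist t t' + B * dist t t' ^ a} := by
          ext g; simp only [Set.mem_iInter]; rfl
        change IsClosed {g : Set.Icc (0:ℝ) 1 → ℝ | ∀ t t' : Set.Icc (0:ℝ) 1,
            |g t - g t'| ≤ A * dist t t' + B * dist t t' ^ a}
        rw [this]
        exact isClosed_iInter fun t => isClosed_iInter fun t' =>
          isClosed_le ((continuous_apply t).sub (continuous_apply t')).abs continuous_const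
    · intro g hg t _
      exact abs_le.1 (hg.1 t)
  · intro t
    rw [Metric.equicontinuousAt_iff]
    intro ε hε
    have h1 := (hequi t).eventually (gt_mem_nhds hε)
    obtain ⟨d, hd, h2⟩ := Metric.eventually_nhds_iff.1 h1
    refine ⟨d, hd, fun t' ht' v => ?_⟩
    have := v.2.2 t t'
    rw [Real.dist_eq]
    exact lt_of_le_of_lt this (h2 ht')

lemma ciBirkhoffKellogg (b σ ρ m A B a : ℝ) (hb : 0 < b) (hσ0 : 0 < σ) (hσ1 : σ ≤ 1)
    (hρ : 0 < ρ) (hm : 0 < m) (hA : 0 ≤ A) (hB : 0 ≤ B) (ha : 0 < a) (T : CI → CI)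
    (hTc : Continuous T)
    (hcone : ∀ u : CI, ∀ t : Set.Icc (0:ℝ) 1, (t : ℝ) ≤ b → σ * ‖T u‖ ≤ T u t)
    (hlow : ∀ u : CI, (∀ t : Set.Icc (0:ℝ) 1, (t : ℝ) ≤ b → σ * ‖u‖ ≤ u t) → ‖u‖ = ρ → m ≤ ‖T u‖)
    (hmod : ∀ u : CI, ‖u‖ = ρ → ∀ t t' : Set.Icc (0:ℝ) 1,
      |T u t - T u t'| ≤ A * dist t t' + B * dist t t' ^ a) :
    ∃ u : CI, ‖u‖ = ρ ∧ 0 < ‖T u‖ ∧ u = (ρ / ‖T u‖) • T u ∧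
      ∀ t : Set.Icc (0:ℝ) 1, (t : ℝ) ≤ b → σ * ‖u‖ ≤ u t := by
  set P : Set CI := {u | ∀ t : Set.Icc (0:ℝ) 1, (t : ℝ) ≤ b → σ * ‖u‖ ≤ u t} with hP
  set D : Set CI := P ∩ {u | ‖u‖ ≤ ρ} with hDdef
  have hPadd : ∀ u ∈ P, ∀ v ∈ P, u + v ∈ P := by
    intro u hu v hv t ht
    have h1 := hu t ht
    have h2 := hv t ht
    have h3 := norm_add_le u v
    rw [ContinuousMap.add_apply]
    nlinarith
  have hPsmul : ∀ u ∈ P, ∀ c : ℝ, 0 ≤ c → c • u ∈ P := by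
    intro u hu c hc t ht
    have h1 := hu t ht
    rw [ContinuousMap.smul_apply, norm_smul, Real.norm_of_nonneg hc, smul_eq_mul]
    nlinarith
  have hPclosed : IsClosed P := by
    have : P = ⋂ t : Set.Icc (0:ℝ) 1, ⋂ _ : (t : ℝ) ≤ b, {u : CI | σ * ‖u‖ ≤ u t} := by
      ext u; simp [hP]
    rw [this]
    exact isClosed_iInter fun t => isClosed_iInter fun _ =>
      isClosed_le (continuous_const.mul continuous_norm) (continuous_eval_const t)
  have hDclosed : IsClosed D := hPclosed.inter (isClosed_le continuous_norm continuous_const)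
  have hDconv : Convex ℝ D := by
    intro u hu v hv c d hc hd hcd
    refine ⟨hPadd _ (hPsmul u hu.1 c hc) _ (hPsmul v hv.1 d hd), ?_⟩
    have h1 := norm_add_le (c • u) (d • v)
    rw [norm_smul, norm_smul, Real.norm_of_nonneg hc, Real.norm_of_nonneg hd] at h1
    have h2 : ‖u‖ ≤ ρ := hu.2
    have h3 : ‖v‖ ≤ ρ := hv.2
    change ‖c • u + d • v‖ ≤ ρ
    calc _ ≤ _ := h1
      _ ≤ c * ρ + d * ρ := by gcongr
      _ = ρ := by rw [← add_mul, hcd, one_mul]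
  let e : CI := 1
  have heP : e ∈ P := by
    intro t _
    have : ‖e‖ = 1 := norm_one
    rw [this]; simpa [e] using hσ1
  have h0P : (0 : CI) ∈ P := by intro t _; simp
  have hDne : D.Nonempty := ⟨0, h0P, by simpa using hρ.le⟩
  -- the retraction of `D` on the sphere
  let q : CI → CI := fun u => u + (ρ - ‖u‖) • e
  have hqc : Continuous q :=
    continuous_id.add ((continuous_const.sub continuous_norm).smul continuous_const)
  have hqP : ∀ u ∈ D, q u ∈ P := fun u hu =>
    hPadd _ hu.1 _ (hPsmul _ heP _ (sub_nonneg.2 hu.2))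
  have hq0 : ∀ u ∈ D, 0 < ‖q u‖ := by
    intro u hu
    rw [norm_pos_iff]
    intro h
    let z : Set.Icc (0:ℝ) 1 := ⟨0, by simp⟩
    have h1 : q u z = 0 := by rw [h]; rfl
    have h2 : q u z = u z + (ρ - ‖u‖) := by simp [q, e]
    have h3 := hu.1 z hb.le
    have h4 : ‖u‖ ≤ ρ := hu.2
    have h5 := norm_nonneg u
    have h6 : 0 ≤ σ * ‖u‖ := by positivity
    have h7 : ‖u‖ = ρ := by linarith
    have h8 : 0 < σ * ‖u‖ := by rw [h7]; positivity
    linarith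
  let r : CI → CI := fun u => (ρ / ‖q u‖) • q u
  have hrc : ContinuousOn r D :=
    (continuousOn_const.div hqc.norm.continuousOn (fun u hu => (hq0 u hu).ne')).smul hqc.continuousOn
  have hrP : ∀ u ∈ D, r u ∈ P := fun u hu =>
    hPsmul _ (hqP u hu) _ (div_nonneg hρ.le (norm_nonneg _))
  have hrn : ∀ u ∈ D, ‖r u‖ = ρ := by
    intro u hu
    have := hq0 u hu
    simp only [r]
    rw [norm_smul, Real.norm_of_nonneg (by positivity)]
    field_simp
  have hrid : ∀ u, ‖u‖ = ρ → r u = u := by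
    intro u hu
    have : q u = u := by simp [q, hu]
    simp only [r]
    rw [this, hu, div_self hρ.ne', one_smul]
  have hTr : ∀ u ∈ D, m ≤ ‖T (r u)‖ := fun u hu => hlow _ (hrP u hu) (hrn u hu)
  let F : CI → CI := fun u => (ρ / ‖T (r u)‖) • T (r u)
  have hTrc : ContinuousOn (fun u => T (r u)) D := hTc.comp_continuousOn hrc
  have hFc : ContinuousOn F D :=
    (continuousOn_const.div hTrc.norm (fun u hu => (lt_of_lt_of_le hm (hTr u hu)).ne')).smul hTrc
  have hFn : ∀ u ∈ D, ‖F u‖ = ρ := by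
    intro u hu
    have := lt_of_lt_of_le hm (hTr u hu)
    simp only [F]
    rw [norm_smul, Real.norm_of_nonneg (by positivity)]
    field_simp
  set K : Set CI := D ∩ {v : CI | (∀ t, |v t| ≤ ρ) ∧
      ∀ t t' : Set.Icc (0:ℝ) 1, |v t - v t'| ≤ (ρ / m * A) * dist t t' + (ρ / m * B) * dist t t' ^ a}
    with hK
  have hKc : IsCompact K := (ciCompact ρ (ρ / m * A) (ρ / m * B) a ha).inter_left hDclosed
  have hFK : Set.MapsTo F D K := by
    intro u hu
    refine ⟨⟨hPsmul _ (hcone (r u)) _ (div_nonneg hρ.le (norm_nonneg _)), (hFn u hu).le⟩, ?_, ?_⟩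
    · intro t
      rw [← hFn u hu, ← Real.norm_eq_abs]
      exact (F u).norm_coe_le_norm t
    · intro t t'
      have h1 := hmod (r u) (hrn u hu) t t'
      have h2 := hTr u hu
      have h3 : ρ / ‖T (r u)‖ ≤ ρ / m := by gcongr
      have h4 : F u t - F u t' = ρ / ‖T (r u)‖ * (T (r u) t - T (r u) t') := by
        simp [F]; ring
      rw [h4, abs_mul, abs_of_nonneg (by positivity)]
      calc _ ≤ ρ / m * (A * dist t t' + B * dist t t' ^ a) := by gcongr
        _ = _ := by ring
  obtain ⟨u, hu, hfix⟩ := sdSchauder D K hDconv hDne hKc Set.inter_subset_left F hFc hFK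
  have hun : ‖u‖ = ρ := by rw [← hfix]; exact hFn u hu
  have hTu := hTr u hu
  rw [hrid u hun] at hTu
  refine ⟨u, hun, lt_of_lt_of_le hm hTu, ?_, hu.1⟩
  conv_lhs => rw [← hfix]
  simp only [F]
  rw [hrid u hun]

/- Kernel estimates -/

/-- Positive part to the power `a`. -/
noncomputable def ppow (a x : ℝ) : ℝ := (max x 0) ^ a

lemma ppow_nonneg (a x : ℝ) : 0 ≤ ppow a x := Real.rpow_nonneg (le_max_right _ _) _

lemma ppow_continuous {a : ℝ} (ha : 0 < a) : Continuous (ppow a) :=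
  (Real.continuous_rpow_const ha.le).comp (continuous_id.max continuous_const)

lemma ppow_mono {a : ℝ} (ha : 0 < a) {x y : ℝ} (h : x ≤ y) : ppow a x ≤ ppow a y :=
  Real.rpow_le_rpow (le_max_right _ _) (max_le_max_right _ h) ha.le

lemma ppow_of_nonneg (a : ℝ) {x : ℝ} (h : 0 ≤ x) : ppow a x = x ^ a := by
  rw [ppow, max_eq_left h]

lemma ppow_sub_le {a : ℝ} (ha : 0 < a) (ha1 : a ≤ 1) {x y : ℝ} (h : x ≤ y) :
    ppow a y ≤ ppow a x + (y - x) ^ a := by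
  have h0 : 0 ≤ y - x := sub_nonneg.2 h
  have h1 : max y 0 ≤ max x 0 + (y - x) := by
    apply max_le
    · linarith [le_max_left x 0]
    · linarith [le_max_right x 0]
  have h2 := NNReal.rpow_add_le_add_rpow (⟨max x 0, le_max_right _ _⟩ : NNReal) ⟨y - x, h0⟩ ha.le ha1
  have h3 : (max x 0 + (y - x)) ^ a ≤ (max x 0) ^ a + (y - x) ^ a := by exact_mod_cast h2
  exact (Real.rpow_le_rpow (le_max_right _ _) h1 ha.le).trans h3

lemma ppow_abs_sub_le {a : ℝ} (ha : 0 < a) (ha1 : a ≤ 1) (x y : ℝ) :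
    |ppow a x - ppow a y| ≤ |x - y| ^ a := by
  rcases le_total x y with h | h
  · rw [abs_sub_comm x y, abs_of_nonneg (sub_nonneg.2 h), abs_sub_comm,
      abs_of_nonneg (sub_nonneg.2 (ppow_mono ha h))]
    linarith [ppow_sub_le ha ha1 h]
  · rw [abs_of_nonneg (sub_nonneg.2 h), abs_of_nonneg (sub_nonneg.2 (ppow_mono ha h))]
    linarith [ppow_sub_le ha ha1 h]

/-- Continuous form of the kernel. -/
noncomputable def kk (α η β t s : ℝ) : ℝ :=
  β + ppow (α - 1) (η - s) / Real.Gamma α - ppow (α - 1) (t - s) / Real.Gamma α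

lemma Kker_eq_kk {α : ℝ} (hα : 1 < α) (η β t : ℝ) {s : ℝ} (hs : 0 ≤ s) :
    Kker α η β t s = kk α η β t s := by
  have h : ∀ r : ℝ, (Set.Icc (0:ℝ) r).indicator (fun x => (r - x) ^ (α - 1) / Real.Gamma α) s =
      ppow (α - 1) (r - s) / Real.Gamma α := by
    intro r
    by_cases hr : s ≤ r
    · rw [Set.indicator_of_mem (show s ∈ Set.Icc 0 r from ⟨hs, hr⟩), ppow_of_nonneg _ (by linarith)]
    · rw [Set.indicator_of_notMem (fun h => hr h.2), ppow, max_eq_right (by linarith),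
        Real.zero_rpow (by linarith), zero_div]
  rw [Kker, kk, h, h]

lemma kk_continuous {α : ℝ} (hα : 1 < α) (η β t : ℝ) : Continuous (fun s => kk α η β t s) := by
  have h := ppow_continuous (a := α - 1) (by linarith)
  unfold kk
  exact (continuous_const.add ((h.comp (continuous_const.sub continuous_id)).div_const _)).sub
    ((h.comp (continuous_const.sub continuous_id)).div_const _)

/-- Existence, Case 3: if `0 < β < min{β_K, β_γ}`, `b ∈ (0, t*)` with
`b ≥ η` and `βΓ(α) > (b−η)^{α−1}`, `f ≥ δ` on `[0,b]×[σ₃ρ,ρ]`, `H₁ ≥ η₁` and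
`H₂ ≥ η₂` on `P_{σ₃} ∩ ∂Ω_ρ`, and `γ(0)η₁ + η₂ + ∫₀ᵇ K(0,s)δ(s) ds > 0`, then there
exist `λ_ρ > 0` and `u_ρ` with `‖u_ρ‖_∞ = ρ`, `u_ρ = λ_ρ·T(u_ρ)` and
`σ₃ρ ≤ u_ρ(t) ≤ ρ` on `[0,b]`. -/
theorem stmt_19
    (α η β : ℝ) (hα1 : 1 < α) (hα2 : α ≤ 2) (hη0 : 0 < η) (hη1 : η < 1) (hβ0 : 0 < β)
    (f : ℝ → ℝ → ℝ)
    (hf : ContinuousOn (fun p : ℝ × ℝ => f p.1 p.2) (Set.Icc (0:ℝ) 1 ×ˢ Set.univ))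
    (hf0 : ∀ t ∈ Set.Icc (0:ℝ) 1, ∀ x : ℝ, 0 ≤ f t x)
    (H₁ H₂ : CI → ℝ) (hH₁c : Continuous H₁) (hH₂c : Continuous H₂)
    (hH₁0 : ∀ u, 0 ≤ H₁ u) (hH₂0 : ∀ u, 0 ≤ H₂ u)
    (hH₁b : ∀ S : Set CI, Bornology.IsBounded S → Bornology.IsBounded (H₁ '' S))
    (hH₂b : ∀ S : Set CI, Bornology.IsBounded S → Bornology.IsBounded (H₂ '' S))
    (T : CI → CI)
    (hT : ∀ (u : CI) (t : Set.Icc (0:ℝ) 1), T u t = H₁ u * gam α η β (t : ℝ) + H₂ u +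
      ∫ s in (0:ℝ)..1, Kker α η β (t : ℝ) s * f s (Set.IccExtend zero_le_one u s))
    (hβ : β < min ((1 - η) ^ (α - 1) / Real.Gamma α) ((1 - η) * Real.Gamma (3 - α)))
    (b : ℝ) (hb0 : 0 < b)
    (hbt : b < min (η + (β * Real.Gamma α) ^ (1 / (α - 1))) (η + β / Real.Gamma (3 - α)))
    (hbη : η ≤ b) (hbβ : (b - η) ^ (α - 1) < β * Real.Gamma α)
    (ρ : ℝ) (hρ : 0 < ρ)
    (σ₃ : ℝ)
    (hσ₃ : σ₃ = min ((β + (η - b) * Real.Gamma (3 - α)) /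
        max (β + η * Real.Gamma (3 - α)) ((1 - η) * Real.Gamma (3 - α) - β))
      (min (min
        ((β * Real.Gamma α - (b - η) ^ (α - 1)) / (β * Real.Gamma α + η ^ (α - 1)))
        ((β * Real.Gamma α - (b - η) ^ (α - 1)) / ((1 - η) ^ (α - 1) - β * Real.Gamma α)))
        1))
    (δ : ℝ → ℝ) (hδc : ContinuousOn δ (Set.Icc (0:ℝ) b))
    (hδ0 : ∀ t ∈ Set.Icc (0:ℝ) b, 0 ≤ δ t)
    (hfδ : ∀ t ∈ Set.Icc (0:ℝ) b, ∀ x ∈ Set.Icc (σ₃ * ρ) ρ, δ t ≤ f t x)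
    (η₁ η₂ : ℝ) (hη₁ : 0 ≤ η₁) (hη₂ : 0 ≤ η₂)
    (hH : ∀ u : CI, (∀ t : Set.Icc (0:ℝ) 1, (t : ℝ) ≤ b → σ₃ * ‖u‖ ≤ u t) → ‖u‖ = ρ →
      η₁ ≤ H₁ u ∧ η₂ ≤ H₂ u)
    (hpos : 0 < gam α η β 0 * η₁ + η₂ + ∫ s in (0:ℝ)..b, Kker α η β 0 s * δ s) :
    ∃ lam : ℝ, 0 < lam ∧ ∃ u : CI, ‖u‖ = ρ ∧ u = lam • T u ∧
      ∀ t : Set.Icc (0:ℝ) 1, (t : ℝ) ≤ b → σ₃ * ρ ≤ u t ∧ u t ≤ ρ := by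
  set a := α - 1 with ha_def
  have ha : 0 < a := by rw [ha_def]; linarith
  have ha1 : a ≤ 1 := by rw [ha_def]; linarith
  set G := Real.Gamma α with hG_def
  have hG : 0 < G := Real.Gamma_pos_of_pos (by linarith)
  set G3 := Real.Gamma (3 - α) with hG3_def
  have hG3 : 0 < G3 := Real.Gamma_pos_of_pos (by linarith)
  have hβK : β * G < (1 - η) ^ a := by
    have := lt_of_lt_of_le hβ (min_le_left _ _)
    rwa [lt_div_iff₀ hG] at this
  have hβγ : β < (1 - η) * G3 := lt_of_lt_of_le hβ (min_le_right _ _)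
  have hb3 : (b - η) * G3 < β := by
    have := lt_of_lt_of_le hbt (min_le_right _ _)
    rw [← lt_div_iff₀ hG3]; linarith
  have hb1 : b < 1 := by
    have h1 : (b - η) * G3 < (1 - η) * G3 := hb3.trans hβγ
    have := lt_of_mul_lt_mul_right h1 hG3.le
    linarith
  have hηa : 0 < η ^ a := Real.rpow_pos_of_pos hη0 a
  -- properties of `σ₃`
  have hM : 0 < max (β + η * G3) ((1 - η) * G3 - β) := lt_max_of_lt_left (by positivity)
  have hd1 : 0 < β * G + η ^ a := by positivity
  have hd2 : 0 < (1 - η) ^ a - β * G := by linarith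
  have hn1 : 0 < β * G - (b - η) ^ a := by linarith
  have hnγ : 0 < β + (η - b) * G3 := by nlinarith
  have hσ0 : 0 < σ₃ := by
    rw [hσ₃]
    exact lt_min (div_pos hnγ hM) (lt_min (lt_min (div_pos hn1 hd1) (div_pos hn1 hd2)) one_pos)
  have hσ1 : σ₃ ≤ 1 := by
    rw [hσ₃]; exact (min_le_right _ _).trans (min_le_right _ _)
  have hσK1 : σ₃ * (β * G + η ^ a) ≤ β * G - (b - η) ^ a := by
    rw [← le_div_iff₀ hd1, hσ₃]
    exact (min_le_right _ _).trans ((min_le_left _ _).trans (min_le_left _ _))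
  have hσK2 : σ₃ * ((1 - η) ^ a - β * G) ≤ β * G - (b - η) ^ a := by
    rw [← le_div_iff₀ hd2, hσ₃]
    exact (min_le_right _ _).trans ((min_le_left _ _).trans (min_le_right _ _))
  have hσγ : σ₃ * max (β + η * G3) ((1 - η) * G3 - β) ≤ β + (η - b) * G3 := by
    rw [← le_div_iff₀ hM, hσ₃]
    exact min_le_left _ _
  clear hσ₃
  -- `γ`
  have hgam : ∀ t, gam α η β t * G3 = β + (η - t) * G3 := by
    intro t; rw [gam, ← hG3_def]; field_simp; ring
  have hγ : ∀ t t' : ℝ, t ≤ b → 0 ≤ t' → t' ≤ 1 → σ₃ * |gam α η β t'| ≤ gam α η β t := by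
    intro t t' ht h0 h1
    apply le_of_mul_le_mul_right _ hG3
    rw [hgam, mul_assoc, ← abs_of_pos hG3, ← abs_mul, abs_of_pos hG3, hgam]
    have h2 : |β + (η - t') * G3| ≤ max (β + η * G3) ((1 - η) * G3 - β) := by
      rw [abs_le']
      constructor
      · apply le_max_of_le_left; nlinarith
      · apply le_max_of_le_right; nlinarith
    calc _ ≤ σ₃ * max (β + η * G3) ((1 - η) * G3 - β) := by gcongr
      _ ≤ _ := hσγ
      _ ≤ _ := by nlinarith
  have hγ0 : 0 ≤ gam α η β 0 := (mul_nonneg hσ0.le (abs_nonneg _)).trans (hγ 0 0 hb0.le le_rfl zero_le_one)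
  -- kernel
  have hkG : ∀ t s, kk α η β t s * G = β * G + ppow a (η - s) - ppow a (t - s) := by
    intro t s; rw [kk, ← hG_def, ← ha_def]; field_simp
  have hkabs : ∀ t s : ℝ, t ≤ 1 → 0 ≤ s → |kk α η β t s| * G ≤ max (β * G + η ^ a) ((1 - η) ^ a - β * G) := by
    intro t s ht hs
    rw [← abs_of_pos hG, ← abs_mul, abs_of_pos hG, hkG, abs_le']
    constructor
    · apply le_max_of_le_left
      have h1 := ppow_mono ha (show η - s ≤ η by linarith)
      rw [ppow_of_nonneg a hη0.le] at h1
      linarith [ppow_nonneg a (t - s)]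
    · apply le_max_of_le_right
      have h1 := ppow_mono ha (show t - s ≤ 1 - s by linarith)
      have h2 := ppow_sub_le ha ha1 (show η - s ≤ 1 - s by linarith)
      rw [show 1 - s - (η - s) = 1 - η by ring] at h2
      linarith
  have hkcone : ∀ t t' s : ℝ, t ≤ b → t' ≤ 1 → 0 ≤ s → σ₃ * |kk α η β t' s| ≤ kk α η β t s := by
    intro t t' s ht ht' hs
    apply le_of_mul_le_mul_right _ hG
    rw [hkG, mul_assoc]
    have h1 := ppow_mono ha (show t - s ≤ b - s by linarith)
    have h2 := ppow_sub_le ha ha1 (show η - s ≤ b - s by linarith)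
    rw [show b - s - (η - s) = b - η by ring] at h2
    calc _ ≤ σ₃ * max (β * G + η ^ a) ((1 - η) ^ a - β * G) := by
          gcongr; exact hkabs t' s ht' hs
      _ ≤ β * G - (b - η) ^ a := by
          rcases max_cases (β * G + η ^ a) ((1 - η) ^ a - β * G) with h | h <;> rw [h.1]
          · exact hσK1
          · exact hσK2
      _ ≤ _ := by linarith
  have hkdiff : ∀ t t' s : ℝ, |kk α η β t s - kk α η β t' s| ≤ |t - t'| ^ a / G := by
    intro t t' s
    have h0 : |kk α η β t s - kk α η β t' s| * G = |(kk α η β t s - kk α η β t' s) * G| := by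
      rw [abs_mul, abs_of_pos hG]
    rw [le_div_iff₀ hG, h0, sub_mul, hkG, hkG]
    have h1 := ppow_abs_sub_le ha ha1 (t' - s) (t - s)
    rw [show t' - s - (t - s) = -(t - t') by ring, abs_neg] at h1
    calc _ = |ppow a (t' - s) - ppow a (t - s)| := by congr 1; ring
      _ ≤ _ := h1
  -- the superposition operator
  have hgc : ∀ u : CI, Continuous (fun s : Set.Icc (0:ℝ) 1 => f s (u s)) := by
    intro u
    have h1 : Continuous (fun s : Set.Icc (0:ℝ) 1 => ((s : ℝ), u s)) :=
      continuous_subtype_val.prodMk u.continuous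
    exact hf.comp_continuous h1 (fun s => ⟨s.2, trivial⟩)
  let g : CI → CI := fun u => ⟨fun s => f s (u s), hgc u⟩
  have hgcont : Continuous g := by
    apply ContinuousMap.continuous_of_continuous_uncurry
    have h1 : Continuous (fun p : CI × Set.Icc (0:ℝ) 1 => ((p.2 : ℝ), p.1 p.2)) :=
      (continuous_subtype_val.comp continuous_snd).prodMk (continuous_fst.eval continuous_snd)
    exact hf.comp_continuous h1 (fun p => ⟨p.2.2, trivial⟩)
  let ge : CI → ℝ → ℝ := fun u => Set.IccExtend zero_le_one (g u)
  have hgec : ∀ u, Continuous (ge u) := fun u => (g u).continuous.Icc_extend'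
  have hge0 : ∀ u s, 0 ≤ ge u s := fun u s => hf0 _ (Set.projIcc 0 1 zero_le_one s).2 _
  have hgen : ∀ u s, |ge u s| ≤ ‖g u‖ := fun u s => (g u).norm_coe_le_norm _
  have hkint : ∀ u t, IntervalIntegrable (fun s => kk α η β t s * ge u s) volume 0 1 :=
    fun u t => ((kk_continuous hα1 η β t).mul (hgec u)).intervalIntegrable _ _
  have hT' : ∀ (u : CI) (t : Set.Icc (0:ℝ) 1), T u t = H₁ u * gam α η β (t : ℝ) + H₂ u +
      ∫ s in (0:ℝ)..1, kk α η β (t : ℝ) s * ge u s := by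
    intro u t
    rw [hT]
    congr 1
    apply intervalIntegral.integral_congr
    intro s hs
    rw [Set.uIcc_of_le zero_le_one] at hs
    simp only [ge]
    rw [Kker_eq_kk hα1 _ _ _ hs.1, Set.IccExtend_of_mem _ _ hs, Set.IccExtend_of_mem _ _ hs]
    rfl
  -- cone invariance
  have hcone : ∀ u : CI, ∀ t : Set.Icc (0:ℝ) 1, (t : ℝ) ≤ b → σ₃ * ‖T u‖ ≤ T u t := by
    intro u t ht
    have hpt : ∀ t' : Set.Icc (0:ℝ) 1, σ₃ * |T u t'| ≤ T u t := by
      intro t'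
      rw [hT' u t, hT' u t']
      have h1 : |∫ s in (0:ℝ)..1, kk α η β (t' : ℝ) s * ge u s| ≤
          ∫ s in (0:ℝ)..1, |kk α η β (t' : ℝ) s * ge u s| :=
        intervalIntegral.abs_integral_le_integral_abs zero_le_one
      have h2 : σ₃ * (∫ s in (0:ℝ)..1, |kk α η β (t' : ℝ) s * ge u s|) ≤
          ∫ s in (0:ℝ)..1, kk α η β (t : ℝ) s * ge u s := by
        rw [← intervalIntegral.integral_const_mul]
        apply intervalIntegral.integral_mono_on zero_le_one
        · exact ((hkint u t').abs).const_mul _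
        · exact hkint u t
        · intro s hs
          rw [abs_mul, abs_of_nonneg (hge0 u s), ← mul_assoc]
          exact mul_le_mul_of_nonneg_right (hkcone t t' s ht t'.2.2 hs.1) (hge0 u s)
      have h3 := hγ t t' ht t'.2.1 t'.2.2
      have h4 : |H₁ u * gam α η β t' + H₂ u + ∫ s in (0:ℝ)..1, kk α η β (t' : ℝ) s * ge u s| ≤
          H₁ u * |gam α η β t'| + H₂ u + |∫ s in (0:ℝ)..1, kk α η β (t' : ℝ) s * ge u s| := by
        refine (abs_add_le _ _).trans (add_le_add_left ((abs_add_le _ _).trans ?_) _)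
        rw [abs_mul, abs_of_nonneg (hH₁0 u), abs_of_nonneg (hH₂0 u)]
      have h5 := mul_le_mul_of_nonneg_left h4 hσ0.le
      have h6 := mul_le_mul_of_nonneg_left h1 hσ0.le
      have h7 := mul_le_mul_of_nonneg_left h3 (hH₁0 u)
      have h8 := mul_le_mul_of_nonneg_right hσ1 (hH₂0 u)
      linarith
    have h0 : 0 ≤ T u t := le_trans (by positivity) (hpt t)
    rw [mul_comm, ← le_div_iff₀ hσ0, ContinuousMap.norm_le _ (by positivity)]
    intro t'
    rw [le_div_iff₀ hσ0, mul_comm]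
    exact hpt t'
  -- lower bound
  have hlow : ∀ u : CI, (∀ t : Set.Icc (0:ℝ) 1, (t : ℝ) ≤ b → σ₃ * ‖u‖ ≤ u t) → ‖u‖ = ρ →
      gam α η β 0 * η₁ + η₂ + (∫ s in (0:ℝ)..b, Kker α η β 0 s * δ s) ≤ ‖T u‖ := by
    intro u hu hun
    obtain ⟨h1, h2⟩ := hH u hu hun
    let z : Set.Icc (0:ℝ) 1 := ⟨0, by simp⟩
    have hk0 : ∀ s, 0 ≤ s → 0 ≤ kk α η β 0 s := fun s hs =>
      le_trans (by positivity) (hkcone 0 0 s hb0.le zero_le_one hs)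
    have h3 : (∫ s in (0:ℝ)..b, Kker α η β 0 s * δ s) ≤ ∫ s in (0:ℝ)..b, kk α η β 0 s * ge u s := by
      have e : (∫ s in (0:ℝ)..b, Kker α η β 0 s * δ s) = ∫ s in (0:ℝ)..b, kk α η β 0 s * δ s := by
        apply intervalIntegral.integral_congr
        intro s hs
        rw [Set.uIcc_of_le hb0.le] at hs
        simp only
        rw [Kker_eq_kk hα1 _ _ _ hs.1]
      rw [e]
      apply intervalIntegral.integral_mono_on hb0.le
      · apply ContinuousOn.intervalIntegrable
        rw [Set.uIcc_of_le hb0.le]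
        exact (kk_continuous hα1 η β 0).continuousOn.mul hδc
      · exact ((kk_continuous hα1 η β 0).mul (hgec u)).intervalIntegrable _ _
      · intro s hs
        apply mul_le_mul_of_nonneg_left _ (hk0 s hs.1)
        have hs1 : s ∈ Set.Icc (0:ℝ) 1 := ⟨hs.1, hs.2.trans hb1.le⟩
        have e2 : ge u s = f s (u ⟨s, hs1⟩) := by
          simp only [ge]; rw [Set.IccExtend_of_mem _ _ hs1]; rfl
        rw [e2]
        apply hfδ s hs
        constructor
        · rw [← hun]; exact hu ⟨s, hs1⟩ hs.2
        · rw [← hun]; exact (le_abs_self _).trans (u.norm_coe_le_norm _)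
    have h4 : (∫ s in (0:ℝ)..b, kk α η β 0 s * ge u s) ≤ ∫ s in (0:ℝ)..1, kk α η β 0 s * ge u s := by
      apply intervalIntegral.integral_mono_interval le_rfl hb0.le hb1.le
      · rw [Filter.EventuallyLE, ae_restrict_iff' measurableSet_Ioc]
        exact Filter.Eventually.of_forall fun s hs => mul_nonneg (hk0 s hs.1.le) (hge0 u s)
      · exact hkint u 0
    have h5 : T u z ≤ ‖T u‖ := (le_abs_self _).trans ((T u).norm_coe_le_norm z)
    have h6 := hT' u z
    have h7 : (z : ℝ) = 0 := rfl
    rw [h7] at h6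
    have h8 := mul_le_mul_of_nonneg_left h1 hγ0
    linarith
  -- continuity of `T`
  set M := max (β * G + η ^ a) ((1 - η) ^ a - β * G) / G with hMdef
  have hkM : ∀ t s : ℝ, t ≤ 1 → 0 ≤ s → |kk α η β t s| ≤ M := fun t s ht hs => by
    rw [hMdef, le_div_iff₀ hG]; exact hkabs t s ht hs
  have hTc : Continuous T := by
    let γc : CI := ⟨fun t => gam α η β t, by unfold gam; fun_prop⟩
    let L : CI → CI := fun u => T u - (H₁ u • γc + H₂ u • (1 : CI))
    have hLap : ∀ u t, L u t = ∫ s in (0:ℝ)..1, kk α η β (t : ℝ) s * ge u s := by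
      intro u t
      simp only [L, γc, ContinuousMap.sub_apply, ContinuousMap.add_apply, ContinuousMap.smul_apply,
        ContinuousMap.coe_mk, ContinuousMap.one_apply, smul_eq_mul]
      rw [hT']; ring
    have hLd : ∀ u v, dist (L u) (L v) ≤ M * dist (g u) (g v) := by
      intro u v
      have hM0 : 0 ≤ M := (abs_nonneg _).trans (hkM 0 0 zero_le_one le_rfl)
      rw [ContinuousMap.dist_le (by positivity)]
      intro t
      rw [hLap, hLap, Real.dist_eq, ← intervalIntegral.integral_sub (hkint u t) (hkint v t)]
      have := intervalIntegral.norm_integral_le_of_norm_le_const (a := (0:ℝ)) (b := 1)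
        (f := fun s => kk α η β (t : ℝ) s * ge u s - kk α η β (t : ℝ) s * ge v s)
        (C := M * dist (g u) (g v)) (by
          intro s hs
          rw [Set.uIoc_of_le zero_le_one] at hs
          rw [← mul_sub, norm_mul]
          apply mul_le_mul (hkM t s t.2.2 hs.1.le) _ (norm_nonneg _) hM0
          rw [← dist_eq_norm]
          exact ContinuousMap.dist_apply_le_dist _)
      simpa using this
    have hLc : Continuous L := by
      rw [continuous_iff_continuousAt]
      intro u
      rw [ContinuousAt, tendsto_iff_dist_tendsto_zero]
      refine squeeze_zero (fun _ => dist_nonneg) (fun v => hLd v u) ?_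
      have h1 : Continuous (fun v => M * dist (g v) (g u)) :=
        continuous_const.mul (hgcont.dist continuous_const)
      have h2 := h1.tendsto u
      simpa using h2
    have : T = fun u => L u + (H₁ u • γc + H₂ u • (1 : CI)) := by
      funext u; simp [L]
    rw [this]
    exact hLc.add ((hH₁c.smul continuous_const).add (hH₂c.smul continuous_const))
  -- equicontinuity
  obtain ⟨A, hA⟩ := (hH₁b _ (Metric.isBounded_sphere (x := (0 : CI)) (r := ρ))).exists_norm_le
  have hcomp : IsCompact (Set.Icc (0:ℝ) 1 ×ˢ Set.Icc (-ρ) ρ) := isCompact_Icc.prod isCompact_Icc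
  obtain ⟨B, hB⟩ := hcomp.exists_bound_of_continuousOn
    (hf.mono (Set.prod_mono subset_rfl (Set.subset_univ _)))
  have hB0 : 0 ≤ B := (norm_nonneg _).trans (hB (0, 0) ⟨by simp, by simp [hρ.le]⟩)
  have hmod : ∀ u : CI, ‖u‖ = ρ → ∀ t t' : Set.Icc (0:ℝ) 1,
      |T u t - T u t'| ≤ |A| * dist t t' + (B / G) * dist t t' ^ a := by
    intro u hun t t'
    have hHA : |H₁ u| ≤ |A| := by
      have := hA (H₁ u) ⟨u, by simp [hun], rfl⟩
      exact this.trans (le_abs_self _)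
    have hgeB : ∀ s ∈ Set.Icc (0:ℝ) 1, |ge u s| ≤ B := by
      intro s hs
      have e2 : ge u s = f s (u ⟨s, hs⟩) := by
        simp only [ge]; rw [Set.IccExtend_of_mem _ _ hs]; rfl
      rw [e2]
      refine hB (s, u ⟨s, hs⟩) ⟨hs, ?_⟩
      have := u.norm_coe_le_norm ⟨s, hs⟩
      rw [hun, Real.norm_eq_abs, abs_le] at this
      exact this
    have hd : dist t t' = |(t : ℝ) - t'| := rfl
    have h1 : |∫ s in (0:ℝ)..1, (kk α η β (t : ℝ) s * ge u s - kk α η β (t' : ℝ) s * ge u s)| ≤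
        (B / G) * dist t t' ^ a := by
      have := intervalIntegral.norm_integral_le_of_norm_le_const (a := (0:ℝ)) (b := 1)
        (f := fun s => kk α η β (t : ℝ) s * ge u s - kk α η β (t' : ℝ) s * ge u s)
        (C := (B / G) * dist t t' ^ a) (by
          intro s hs
          rw [Set.uIoc_of_le zero_le_one] at hs
          rw [← sub_mul, norm_mul, hd]
          calc _ ≤ |(t : ℝ) - t'| ^ a / G * B :=
                mul_le_mul (hkdiff t t' s) (hgeB s ⟨hs.1.le, hs.2⟩) (abs_nonneg _) (by positivity)
            _ = _ := by ring)
      simpa using this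
    have h2 : T u t - T u t' = H₁ u * ((t' : ℝ) - t) +
        ∫ s in (0:ℝ)..1, (kk α η β (t : ℝ) s * ge u s - kk α η β (t' : ℝ) s * ge u s) := by
      rw [intervalIntegral.integral_sub (hkint u t) (hkint u t'), hT', hT', gam, gam]; ring
    rw [h2]
    refine (abs_add_le _ _).trans (add_le_add ?_ h1)
    rw [abs_mul, hd, abs_sub_comm (t : ℝ) t']
    exact mul_le_mul_of_nonneg_right hHA (abs_nonneg _)
  obtain ⟨u, hun, hTu, hfix, huc⟩ := ciBirkhoffKellogg b σ₃ ρ _ |A| (B / G) a hb0 hσ0 hσ1 hρ hpos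
    (abs_nonneg _) (by positivity) ha T hTc hcone hlow hmod
  refine ⟨ρ / ‖T u‖, by positivity, u, hun, hfix, fun t ht => ⟨?_, ?_⟩⟩
  · rw [← hun]; exact huc t ht
  · rw [← hun]; exact (le_abs_self _).trans (u.norm_coe_le_norm t)
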